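/- Let M and N be model categories and let (F, U, adj) be a Quillen adjunction: an adjunction adj : F ⊣ U with F : M ⥤ N preserving cofibrations and trivial cofibrations (equivalently, U preserving fibrations and trivial fibrations). Let γ_M : M ⥤ Ho(M) and γ_N : N ⥤ Ho(N) be localizations at the respective classes of weak equivalences, let (LF, α) be a right Kan extension of F ⋙ γ_N along γ_M, and let (RU, β) be a left Kan extension of U ⋙ γ_M along γ_N. Then there is an adjunction LF ⊣ RU between the homotopy categories Ho(M) and Ho(N). -/

import Mathlib

open CategoryTheory CategoryTheory.Limits

universe v u v₁ u₁ v₂ u₂ v₃ u₃ v₄ u₄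

namespace ModelCategoryStatement

variable {M : Type u} [Category.{v} M]

/-- `f` is a retract of `g`: there are commuting squares exhibiting `f` as a retract
of `g` in the arrow category. -/
def IsRetractOf {X Y X' Y' : M} (f : X ⟶ Y) (g : X' ⟶ Y') : Prop :=
  ∃ (i : X ⟶ X') (r : X' ⟶ X) (i' : Y ⟶ Y') (r' : Y' ⟶ Y),
    i ≫ r = 𝟙 X ∧ i' ≫ r' = 𝟙 Y ∧ i ≫ g = f ≫ i' ∧ g ≫ r' = r ≫ f

/-- A model category: a category with finite limits and colimits, equipped with three
classes of morphisms (weak equivalences, cofibrations, fibrations) satisfying two-out-of-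
three, closure under retracts, the lifting axioms and the factorization axioms. -/
class ModelCategory (M : Type u) [Category.{v} M] where
  weq : MorphismProperty M
  cof : MorphismProperty M
  fib : MorphismProperty M
  hasFiniteLimits : HasFiniteLimits M
  hasFiniteColimits : HasFiniteColimits M
  weq_twoOutOfThree : weq.HasTwoOutOfThreeProperty
  weq_retract : ∀ {X Y X' Y' : M} (f : X ⟶ Y) (g : X' ⟶ Y'),
    IsRetractOf f g → weq g → weq f
  cof_retract : ∀ {X Y X' Y' : M} (f : X ⟶ Y) (g : X' ⟶ Y'),
    IsRetractOf f g → cof g → cof f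
  fib_retract : ∀ {X Y X' Y' : M} (f : X ⟶ Y) (g : X' ⟶ Y'),
    IsRetractOf f g → fib g → fib f
  lift_cof_trivFib : ∀ {A B X Y : M} (i : A ⟶ B) (p : X ⟶ Y),
    cof i → fib p → weq p → HasLiftingProperty i p
  lift_trivCof_fib : ∀ {A B X Y : M} (i : A ⟶ B) (p : X ⟶ Y),
    cof i → weq i → fib p → HasLiftingProperty i p
  fact_cof_trivFib : ∀ {X Y : M} (f : X ⟶ Y),
    ∃ (Z : M) (g : X ⟶ Z) (h : Z ⟶ Y), cof g ∧ fib h ∧ weq h ∧ g ≫ h = f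
  fact_trivCof_fib : ∀ {X Y : M} (f : X ⟶ Y),
    ∃ (Z : M) (g : X ⟶ Z) (h : Z ⟶ Y), cof g ∧ weq g ∧ fib h ∧ g ≫ h = f

attribute [instance] ModelCategory.hasFiniteLimits ModelCategory.hasFiniteColimits

variable (M) in
/-- The weak equivalences of a model category. -/
abbrev weq [ModelCategory M] : MorphismProperty M := ModelCategory.weq

variable (M) in
/-- The cofibrations of a model category. -/
abbrev cof [ModelCategory M] : MorphismProperty M := ModelCategory.cof

variable (M) in
/-- The fibrations of a model category. -/
abbrev fib [ModelCategory M] : MorphismProperty M := ModelCategory.fib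

/-- An object is cofibrant if the map from the initial object is a cofibration. -/
def Cofibrant [ModelCategory M] (X : M) : Prop :=
  cof M (initial.to X)

/-- An object is fibrant if the map to the terminal object is a fibration. -/
def Fibrant [ModelCategory M] (X : M) : Prop :=
  fib M (terminal.from X)


section KanExtensionOpposite

variable {C D H : Type*} [Category* C] [Category* D] [Category* H]
  {L : C ⥤ D} {F : C ⥤ H} {E : D ⥤ H}

/-- The opposite of a right Kan extension is a left Kan extension. -/
theorem isLeftKanExtension_op (α : L ⋙ E ⟶ F) [E.IsRightKanExtension α] :
    E.op.IsLeftKanExtension (show F.op ⟶ L.op ⋙ E.op from NatTrans.op α) where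
  nonempty_isUniversal := by
    let desc (T : Functor.LeftExtension L.op F.op) : T.right.unop ⟶ E :=
      E.liftOfIsRightKanExtension α T.right.unop
        { app X := (T.hom.app (Opposite.op X)).unop
          naturality X Y f := Quiver.Hom.op_inj (T.hom.naturality f.op).symm }
    refine ⟨IsInitial.ofUniqueHom
      (fun T ↦ StructuredArrow.homMk
        { app Y := ((desc T).app Y.unop).op
          naturality X Y f := Quiver.Hom.unop_inj ((desc T).naturality f.unop).symm } ?_) ?_⟩
    · ext X
      exact Quiver.Hom.unop_inj (E.liftOfIsRightKanExtension_fac_app α _ _ X.unop)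
    · intro T m
      ext Y
      let μ : T.right.unop ⟶ E :=
        { app Y := (m.right.app (Opposite.op Y)).unop
          naturality X Y f := Quiver.Hom.op_inj (m.right.naturality f.op).symm }
      have h : μ = desc T := E.hom_ext_of_isRightKanExtension α _ _ (by
        ext X
        refine Eq.trans (Quiver.Hom.op_inj ?_)
          (E.liftOfIsRightKanExtension_fac_app α _ _ X).symm
        exact congr_app (StructuredArrow.w m) (Opposite.op X))
      exact Quiver.Hom.unop_inj (congr_app h Y.unop)

/-- A natural transformation whose opposite exhibits a left Kan extension exhibits a right
Kan extension. -/
theorem isRightKanExtension_of_op (α : L ⋙ E ⟶ F)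
    [E.op.IsLeftKanExtension (show F.op ⟶ L.op ⋙ E.op from NatTrans.op α)] :
    E.IsRightKanExtension α where
  nonempty_isUniversal := by
    let α' : F.op ⟶ L.op ⋙ E.op := NatTrans.op α
    have : E.op.IsLeftKanExtension α' := ‹_›
    let lift (T : Functor.RightExtension L F) : T.left ⟶ E :=
      NatTrans.removeOp (E.op.descOfIsLeftKanExtension α' T.left.op (NatTrans.op T.hom))
    refine ⟨IsTerminal.ofUniqueHom (fun T ↦ CostructuredArrow.homMk (lift T) ?_) ?_⟩
    · ext X
      exact Quiver.Hom.op_inj (E.op.descOfIsLeftKanExtension_fac_app α' _ _ (Opposite.op X))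
    · intro T m
      have h : NatTrans.op m.left =
          E.op.descOfIsLeftKanExtension α' T.left.op (NatTrans.op T.hom) :=
        E.op.hom_ext_of_isLeftKanExtension α' _ _ (by
          ext X
          refine Eq.trans (Quiver.Hom.unop_inj ?_)
            (E.op.descOfIsLeftKanExtension_fac_app α' _ _ X).symm
          exact congr_app (CostructuredArrow.w m) X.unop)
      ext Y
      exact Quiver.Hom.op_inj (congr_app h (Opposite.op Y))

end KanExtensionOpposite

/-- A left derivability structure detects left derived functors of the functors it derives. -/
theorem isLeftDerivedFunctor_iff_isIso {C₁ C₂ D₂ H : Type*} [Category* C₁] [Category* C₂]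
    [Category* D₂] [Category* H] {W₁ : MorphismProperty C₁} {W₂ : MorphismProperty C₂}
    {Φ : LocalizerMorphism W₁ W₂} [Φ.IsLeftDerivabilityStructure] {G : C₂ ⥤ H}
    (h : Φ.Derives G) {L : C₂ ⥤ D₂} [L.IsLocalization W₂] {LG : D₂ ⥤ H}
    (α : L ⋙ LG ⟶ G) :
    LG.IsLeftDerivedFunctor α W₂ ↔ ∀ X, IsIso (α.app (Φ.functor.obj X)) := by
  let α' : G.op ⟶ L.op ⋙ LG.op := NatTrans.op α
  have h' : Φ.op.Derives G.op := h.op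
  have key : LG.IsLeftDerivedFunctor α W₂ ↔ LG.op.IsRightDerivedFunctor α' W₂.op := by
    rw [Functor.isLeftDerivedFunctor_iff_isRightKanExtension,
      Functor.isRightDerivedFunctor_iff_isLeftKanExtension]
    exact ⟨fun _ ↦ isLeftKanExtension_op α, fun _ ↦ isRightKanExtension_of_op α⟩
  rw [key, h'.isRightDerivedFunctor_iff_isIso]
  exact ⟨fun hα X ↦ (isIso_op_iff _).1 (hα (Opposite.op X)),
    fun hα X ↦ (isIso_op_iff _).2 (hα X.unop)⟩

section BrownLemma

open HomotopicalAlgebra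

variable {C H : Type*} [Category* C] [Category* H] [HomotopicalAlgebra.ModelCategory C]

/-- Ken Brown lemma: a functor inverting trivial cofibrations inverts weak equivalences
between cofibrant objects. -/
theorem cofibrantObject_derives {G : C ⥤ H} (hG : (trivialCofibrations C).IsInvertedBy G) :
    (CofibrantObject.localizerMorphism C).Derives G := by
  intro X Y f hf
  have hf' : WeakEquivalence f.hom := ⟨hf⟩
  let b : CofibrantBrownFactorization f.hom := Classical.arbitrary _
  have hi : IsIso (G.map b.i) := hG _ ⟨b.hi, mem_weakEquivalences b.i⟩
  have hs : IsIso (G.map b.s) := hG _ (mem_trivialCofibrations b.s)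
  have hp : IsIso (G.map b.s ≫ G.map b.p) := by
    rw [← G.map_comp, b.s_p, G.map_id]
    infer_instance
  have := IsIso.of_isIso_comp_left (G.map b.s) (G.map b.p)
  change IsIso (G.map f.hom)
  rw [← b.fac, G.map_comp]
  infer_instance

/-- Ken Brown lemma: a functor inverting trivial fibrations inverts weak equivalences
between fibrant objects. -/
theorem fibrantObject_derives {G : C ⥤ H} (hG : (trivialFibrations C).IsInvertedBy G) :
    (FibrantObject.localizerMorphism C).Derives G := by
  intro X Y f hf
  have hf' : WeakEquivalence f.hom := ⟨hf⟩
  let b : FibrantBrownFactorization f.hom := Classical.arbitrary _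
  have hp : IsIso (G.map b.p) := hG _ ⟨b.hp, mem_weakEquivalences b.p⟩
  have hr : IsIso (G.map b.r) := hG _ (mem_trivialFibrations b.r)
  have hi : IsIso (G.map b.i ≫ G.map b.r) := by
    rw [← G.map_comp, b.i_r, G.map_id]
    infer_instance
  have := IsIso.of_isIso_comp_right (G.map b.i) (G.map b.r)
  change IsIso (G.map f.hom)
  rw [← b.fac, G.map_comp]
  infer_instance

end BrownLemma

section DerivedAdjunction

open HomotopicalAlgebra Functor

variable {C D HC HD : Type*} [Category* C] [Category* D] [Category* HC] [Category* HD]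
  [HomotopicalAlgebra.ModelCategory C] [HomotopicalAlgebra.ModelCategory D]
  {F : C ⥤ D} {U : D ⥤ C}

/-- If a left adjoint preserves cofibrations, then its right adjoint preserves trivial
fibrations. -/
theorem trivialFibrations_map_rightAdjoint (adj : F ⊣ U)
    (hF : cofibrations C ≤ (cofibrations D).inverseImage F) :
    trivialFibrations D ≤ (trivialFibrations C).inverseImage U := by
  intro X Y p hp
  rw [MorphismProperty.inverseImage_iff,
    ← MorphismProperty.rlp_eq_of_wfs (cofibrations C) (trivialFibrations C)]
  intro A B i hi
  rw [← adj.hasLiftingProperty_iff]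
  exact MorphismProperty.hasLiftingProperty_of_wfs _ _ (hF _ hi) hp

/-- The derived adjunction of a Quillen adjunction. -/
theorem nonempty_derivedAdjunction (adj : F ⊣ U)
    (hF : cofibrations C ≤ (cofibrations D).inverseImage F)
    (hF' : trivialCofibrations C ≤ (trivialCofibrations D).inverseImage F)
    {LC : C ⥤ HC} [LC.IsLocalization (weakEquivalences C)]
    {LD : D ⥤ HD} [LD.IsLocalization (weakEquivalences D)]
    {LF : HC ⥤ HD} (α : LC ⋙ LF ⟶ F ⋙ LD)
    [LF.IsLeftDerivedFunctor α (weakEquivalences C)]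
    {RU : HD ⥤ HC} (β : U ⋙ LC ⟶ LD ⋙ RU)
    [RU.IsRightDerivedFunctor β (weakEquivalences D)] :
    Nonempty (LF ⊣ RU) := by
  have hL : (trivialCofibrations C).IsInvertedBy (F ⋙ LD) := fun _ _ f hf ↦
    Localization.inverts LD (weakEquivalences D) _ (hF' f hf).2
  have hR : (trivialFibrations D).IsInvertedBy (U ⋙ LC) := fun _ _ f hf ↦
    Localization.inverts LC (weakEquivalences C) _
      (trivialFibrations_map_rightAdjoint adj hF f hf).2
  have hα := (isLeftDerivedFunctor_iff_isIso (cofibrantObject_derives hL) α).1 inferInstance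
  have hβ := ((fibrantObject_derives hR).isRightDerivedFunctor_iff_isIso β).1 inferInstance
  have hL' : (trivialCofibrations C).IsInvertedBy (F ⋙ LD ⋙ RU) :=
    MorphismProperty.IsInvertedBy.of_comp _ _ hL RU
  have hR' : (trivialFibrations D).IsInvertedBy (U ⋙ LC ⋙ LF) :=
    MorphismProperty.IsInvertedBy.of_comp _ _ hR LF
  have : (LF ⋙ RU).IsLeftDerivedFunctor
      ((Functor.associator _ _ _).inv ≫ whiskerRight α RU) (weakEquivalences C) := by
    rw [isLeftDerivedFunctor_iff_isIso (cofibrantObject_derives hL')]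
    intro X
    have := hα X
    simpa using inferInstanceAs (IsIso (RU.map (α.app _)))
  have : (RU ⋙ LF).IsRightDerivedFunctor
      (whiskerRight β LF ≫ (Functor.associator _ _ _).hom) (weakEquivalences D) := by
    rw [(fibrantObject_derives hR').isRightDerivedFunctor_iff_isIso]
    intro X
    have := hβ X
    simpa using inferInstanceAs (IsIso (LF.map (β.app _)))
  exact ⟨adj.derived (weakEquivalences C) (weakEquivalences D) α β⟩

end DerivedAdjunction

section Comparison

variable {C : Type*} [Category* C]

theorem IsRetractOf.of_retractArrow {X Y X' Y' : C} {f : X ⟶ Y} {g : X' ⟶ Y'}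
    (h : RetractArrow f g) : IsRetractOf f g :=
  ⟨h.i.left, h.r.left, h.i.right, h.r.right, h.retract_left, h.retract_right, h.i_w, h.r_w.symm⟩

variable (C) in
/-- The model category structure in the sense of Mathlib. -/
abbrev toHomotopicalAlgebra [ModelCategory C] : HomotopicalAlgebra.ModelCategory C where
  categoryWithFibrations := ⟨fib C⟩
  categoryWithCofibrations := ⟨cof C⟩
  categoryWithWeakEquivalences := ⟨weq C⟩
  cm2 := ModelCategory.weq_twoOutOfThree
  cm3a := ⟨fun h hg ↦ ModelCategory.weq_retract _ _ (.of_retractArrow h) hg⟩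
  cm3b := ⟨fun h hg ↦ ModelCategory.fib_retract _ _ (.of_retractArrow h) hg⟩
  cm3c := ⟨fun h hg ↦ ModelCategory.cof_retract _ _ (.of_retractArrow h) hg⟩
  cm4a i p hi hw hp := ModelCategory.lift_trivCof_fib i p hi.mem hw.mem hp.mem
  cm4b i p hi hp hw := ModelCategory.lift_cof_trivFib i p hi.mem hp.mem hw.mem
  cm5a := ⟨fun f ↦ by
    obtain ⟨Z, g, h, hg, hg', hh, fac⟩ := ModelCategory.fact_trivCof_fib f
    exact ⟨{ Z := Z, i := g, p := h, fac := fac, hi := ⟨hg, hg'⟩, hp := hh }⟩⟩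
  cm5b := ⟨fun f ↦ by
    obtain ⟨Z, g, h, hg, hh, hh', fac⟩ := ModelCategory.fact_cof_trivFib f
    exact ⟨{ Z := Z, i := g, p := h, fac := fac, hi := hg, hp := ⟨hh, hh'⟩ }⟩⟩

end Comparison

/-- A Quillen adjunction `(F, U, adj)` between model categories induces a derived adjunction
`LF ⊣ RU` between the homotopy categories, where `LF` is the total left derived functor of
`F` (a right Kan extension of `F ⋙ γ_N` along `γ_M`) and `RU` is the total right derived
functor of `U` (a left Kan extension of `U ⋙ γ_M` along `γ_N`). -/
theorem quillenAdjunction_derived_adjunction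
    {M : Type u₁} [Category.{v₁} M] [ModelCategory M]
    {N : Type u₂} [Category.{v₂} N] [ModelCategory N]
    (F : M ⥤ N) (U : N ⥤ M) (adj : F ⊣ U)
    (hF_cof : ∀ {X Y : M} (f : X ⟶ Y), cof M f → cof N (F.map f))
    (hF_trivCof : ∀ {X Y : M} (f : X ⟶ Y), cof M f → weq M f →
      cof N (F.map f) ∧ weq N (F.map f))
    {HM : Type u₃} [Category.{v₃} HM] (γM : M ⥤ HM) [γM.IsLocalization (weq M)]
    {HN : Type u₄} [Category.{v₄} HN] (γN : N ⥤ HN) [γN.IsLocalization (weq N)]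
    (LF : HM ⥤ HN) (α : γM ⋙ LF ⟶ F ⋙ γN) [LF.IsRightKanExtension α]
    (RU : HN ⥤ HM) (β : U ⋙ γM ⟶ γN ⋙ RU) [RU.IsLeftKanExtension β] :
    Nonempty (LF ⊣ RU) := by
  let _ := toHomotopicalAlgebra M
  let _ := toHomotopicalAlgebra N
  have : γM.IsLocalization (HomotopicalAlgebra.weakEquivalences M) := ‹γM.IsLocalization (weq M)›
  have : γN.IsLocalization (HomotopicalAlgebra.weakEquivalences N) := ‹γN.IsLocalization (weq N)›
  have : LF.IsLeftDerivedFunctor α (HomotopicalAlgebra.weakEquivalences M) := ⟨inferInstance⟩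
  have : RU.IsRightDerivedFunctor β (HomotopicalAlgebra.weakEquivalences N) := ⟨inferInstance⟩
  exact nonempty_derivedAdjunction adj (fun _ _ f hf ↦ hF_cof f hf)
    (fun _ _ f hf ↦ hF_trivCof f hf.1 hf.2) α β

end ModelCategoryStatement
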